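/- arXiv:1808.09086 — 2 statements merged into one kernel-verified Lean document; each statement's English description precedes it below -/
import Mathlib

section
/- Let k ≥ 2 and let (F_n)_{n∈ℤ} be a family of C^∞ functions F_n : ℝ^{2k} → ℝ of the variables (x_{n+k−1}, …, x_{n−k}) with ∂F_n/∂x_{n−k} nowhere zero. Suppose a discrete Lagrangian (L_n) of order k is a Lagrangian for the recurrence x_{n+k} = F_n(x_{n+k−1}, …, x_{n−k}), i.e. for every n ∈ ℤ and all real (x_{n+k−1}, …, x_{n−k}), substituting x_{n+k} = F_n(x_{n+k−1}, …, x_{n−k}) into the discrete Euler–Lagrange expression gives Σ_{l=0}^{k} ∂_{l+1} L_{n−l}(x_{n+k−l}, …, x_{n−l}) = 0 identically. Let ℓ_{n−k}(x_n, …, x_{n−k}) = ∂₁L_{n−k}(x_n, …, x_{n−k}) denote the partial derivative of L_{n−k} with respect to its first argument. Then for every m = 1, …, k−1 the following identity holds on all of ℝ^{2k}: ∂/∂x_{n−k}[ (∂F_n/∂x_{n−k})^{−1} · ( (∂F_n/∂x_{n−m}) ∂ℓ_{n−k}/∂x_{n−k} − (∂F_n/∂x_{n−k}) ∂ℓ_{n−k}/∂x_{n−m}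 ) ] = 0, where ℓ_{n−k} is regarded as a function of the 2k variables (x_{n+k−1}, …, x_{n−k}) through the variables (x_n, …, x_{n−k}). -/
/-- Partial derivative of `f : ℝ^N → ℝ` with respect to the `i`-th coordinate. -/
noncomputable def pd {N : ℕ} (f : (Fin N → ℝ) → ℝ) (i : Fin N) (x : Fin N → ℝ) : ℝ :=
  fderiv ℝ f x (Pi.single i 1)

/-- The discrete Euler--Lagrange expression of a discrete Lagrangian of order `k`:
`E(L)_n(x) = ∑_{l=0}^{k} ∂L_{n-l}/∂x_n (x_{n+k-l},…,x_{n-l})`, where the `2k+1`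
variables `(x_{n+k},…,x_{n-k})` are encoded as `x : Fin (2k+1) → ℝ` with index `m`
corresponding to `x_{n+k-m}`, and each `L_n : ℝ^{k+1} → ℝ` is written
`L_n(x_{n+k},…,x_n)` (argument slot `j` corresponding to `x_{n+k-j}`). -/
noncomputable def elSum (k : ℕ) (L : ℤ → (Fin (k + 1) → ℝ) → ℝ) (n : ℤ)
    (x : Fin (2 * k + 1) → ℝ) : ℝ :=
  ∑ l : Fin (k + 1),
    pd (L (n - l.val)) ⟨k - l.val, by omega⟩
      (fun j : Fin (k + 1) => x ⟨l.val + j.val, by have := l.isLt; have := j.isLt; omega⟩)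

/-- `ℓ_{n-k}(x_n,…,x_{n-k}) = ∂₁ L_{n-k}(x_n,…,x_{n-k})`, regarded as a function of
the `2k` variables `(x_{n+k-1},…,x_{n-k})` (index `i` corresponds to
`x_{n+k-1-i}`, so `x_{n-s}` is index `k-1+s`). -/
noncomputable def ellFwd (k : ℕ) (hk : 1 ≤ k) (L : ℤ → (Fin (k + 1) → ℝ) → ℝ)
    (n : ℤ) (y : Fin (2 * k) → ℝ) : ℝ :=
  pd (L (n - k)) 0
    (fun s : Fin (k + 1) => y ⟨k - 1 + s.val, by have := s.isLt; omega⟩)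

theorem contDiff_pd {N : ℕ} {f : (Fin N → ℝ) → ℝ} (hf : ContDiff ℝ (⊤ : ℕ∞) f) (i : Fin N) :
    ContDiff ℝ (⊤ : ℕ∞) (pd f i) :=
  (hf.fderiv_right (m := (⊤ : ℕ∞)) (by simp)).clm_apply contDiff_const

/-- A function invariant under translations along the `i`-th axis has vanishing `i`-th partial
derivative. -/
theorem pd_eq_zero_of_translation_invariant {N : ℕ} {f : (Fin N → ℝ) → ℝ} {i : Fin N}
    (h : ∀ z (t : ℝ), f (z + t • Pi.single i 1) = f z) (z : Fin N → ℝ) : pd f i z = 0 := by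
  by_cases hd : DifferentiableAt ℝ f z
  · rw [pd, ← hd.lineDeriv_eq_fderiv, lineDeriv]
    simp [h]
  · simp [pd, fderiv_zero_of_not_differentiableAt hd]

/-- Partial derivatives inherit translation invariance. -/
theorem pd_add_of_translation_invariant {N : ℕ} {f : (Fin N → ℝ) → ℝ} {v : Fin N → ℝ}
    (h : ∀ z, f (z + v) = f z) (j : Fin N) (z : Fin N → ℝ) : pd f j (z + v) = pd f j z := by
  rw [pd, pd, ← fderiv_comp_add_right, funext h]

/-- Chain rule for a substitution of `f z` in the first slot, in a direction that does not affect
the other slots. -/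
theorem pd_comp_cons {N M : ℕ} {f : (Fin N → ℝ) → ℝ} {h : (Fin (M + 1) → ℝ) → ℝ}
    (hf : Differentiable ℝ f) (hh : Differentiable ℝ h) (σ : Fin M → Fin N) (i : Fin N)
    (hi : ∀ j, σ j ≠ i) (z : Fin N → ℝ) :
    pd (fun z => h (Fin.cons (f z) (fun j => z (σ j)))) i z =
      pd f i z * pd h 0 (Fin.cons (f z) (fun j => z (σ j))) := by
  let w' : (Fin N → ℝ) →L[ℝ] (Fin (M + 1) → ℝ) :=
    ContinuousLinearMap.pi (Fin.cons (fderiv ℝ f z) (fun j => ContinuousLinearMap.proj (σ j)))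
  have hw : HasFDerivAt (fun z : Fin N → ℝ => (Fin.cons (f z) (fun j => z (σ j)) : Fin (M + 1) → ℝ))
      w' z := by
    rw [hasFDerivAt_pi']
    refine Fin.cases ?_ fun j => ?_
    · exact (hf z).hasFDerivAt
    · exact hasFDerivAt_apply (σ j) z
  have hw1 : w' (Pi.single i 1) = pd f i z • Pi.single 0 1 := by
    ext j
    refine Fin.cases ?_ (fun j => ?_) j
    · simp [w', pd]
    · simp [w', hi j]
  have hc := (hh (Fin.cons (f z) (fun j => z (σ j)))).hasFDerivAt.comp z hw
  rw [pd, show (fun z => h (Fin.cons (f z) (fun j => z (σ j)))) =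
    h ∘ fun z => (Fin.cons (f z) (fun j => z (σ j)) : Fin (M + 1) → ℝ) from rfl, hc.fderiv]
  rw [ContinuousLinearMap.comp_apply, hw1, map_smul, smul_eq_mul, pd, pd]

/-- On solutions, the outer terms of the Euler--Lagrange expression sum to a function that does not
depend on `x_{n-k}`. -/
theorem outer_terms_translation_invariant (k : ℕ) (hk : 1 ≤ k) (f : (Fin (2 * k) → ℝ) → ℝ)
    (L : ℤ → (Fin (k + 1) → ℝ) → ℝ) (n : ℤ)
    (hEL : ∀ y : Fin (2 * k) → ℝ, elSum k L n (Fin.cons (f y) y) = 0)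
    (z : Fin (2 * k) → ℝ) (t : ℝ) :
    let g : (Fin (2 * k) → ℝ) → ℝ := fun y => ellFwd k hk L n y +
      pd (L n) (Fin.last k) (Fin.cons (f y) fun j : Fin k => y ⟨j, by omega⟩)
    g (z + t • Pi.single ⟨2 * k - 1, by omega⟩ 1) = g z := by
  intro g
  obtain ⟨K, rfl⟩ : ∃ K, k = K + 1 := ⟨k - 1, by omega⟩
  have key : ∀ y, g y = -∑ l : Fin K, pd (L (n - (l.val + 1 : ℕ))) ⟨K - l.val, by omega⟩
      (fun j : Fin (K + 1 + 1) => y ⟨l.val + j.val, by omega⟩) := by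
    intro y
    have h := hEL y
    rw [elSum, Fin.sum_univ_castSucc, Fin.sum_univ_succ] at h
    have h0 : ∀ {a b : ℤ} {i j : Fin (K + 1 + 1)} {u v : Fin (K + 1 + 1) → ℝ}, a = b → i = j →
        u = v → pd (L a) i u = pd (L b) j v := by
      rintro a b i j u v rfl rfl rfl
      rfl
    have hcons : ∀ (i : ℕ) (hi : i + 1 < 2 * (K + 1) + 1),
        (Fin.cons (f y) y : Fin (2 * (K + 1) + 1) → ℝ) ⟨i + 1, hi⟩ = y ⟨i, by omega⟩ :=
      fun i hi => rfl
    rw [eq_neg_iff_add_eq_zero, ← h]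
    simp only [g, ellFwd]
    rw [add_comm (pd (L (n - ↑(K + 1))) _ _), add_assoc, add_comm (pd (L (n - ↑(K + 1))) _ _),
      ← add_assoc]
    congr 1
    · congr 1
      · refine h0 (by simp) (by ext; simp) ?_
        ext j
        refine Fin.cases ?_ (fun j => ?_) j
        · rfl
        · simp only [Fin.cons_succ]
          rw [← hcons _ (by omega)]
          congr 1
          ext
          simp
      · refine Finset.sum_congr rfl fun l _ => h0 (by simp) (by ext; simp) ?_
        ext j
        rw [← hcons _ (by omega)]
        congr 1
        ext
        simp
        omega
    · refine h0 (by simp) (by ext; simp) ?_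
      ext j
      rw [← hcons _ (by omega)]
      congr 1
      ext
      simp
      omega
  rw [key, key]
  refine congrArg Neg.neg (Finset.sum_congr rfl fun l _ => congrArg _ (funext fun j => ?_))
  have : (⟨l.val + j.val, by omega⟩ : Fin (2 * (K + 1))) ≠ ⟨2 * (K + 1) - 1, by omega⟩ := by
    simp only [ne_eq, Fin.mk.injEq]
    omega
  rw [Pi.add_apply, Pi.smul_apply, Pi.single_eq_of_ne this, smul_zero, add_zero]

/-- If a discrete Lagrangian `(L_n)` of order `k ≥ 2` is a Lagrangian for the
recurrence `x_{n+k} = F_n(x_{n+k-1},…,x_{n-k})`, then `ℓ_{n-k} = ∂₁L_{n-k}`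
satisfies, for every `m = 1,…,k-1`,
`∂/∂x_{n-k}[ (∂F_n/∂x_{n-k})⁻¹ ⬝ ( (∂F_n/∂x_{n-m}) ∂ℓ/∂x_{n-k}
  - (∂F_n/∂x_{n-k}) ∂ℓ/∂x_{n-m} ) ] = 0` identically on `ℝ^{2k}`.
Variables `(x_{n+k-1},…,x_{n-k})` are encoded as `Fin (2k) → ℝ` with index `i`
corresponding to `x_{n+k-1-i}`: `x_{n-k}` is index `2k-1`, `x_{n-m}` is `k-1+m`. -/
theorem forward_lagrangian_conditions (k : ℕ) (hk : 2 ≤ k)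
    (F : ℤ → (Fin (2 * k) → ℝ) → ℝ) (hF : ∀ n, ContDiff ℝ (⊤ : ℕ∞) (F n))
    (hFnd : ∀ (n : ℤ) (y : Fin (2 * k) → ℝ), pd (F n) ⟨2 * k - 1, by omega⟩ y ≠ 0)
    (L : ℤ → (Fin (k + 1) → ℝ) → ℝ) (hL : ∀ n, ContDiff ℝ (⊤ : ℕ∞) (L n))
    (hEL : ∀ (n : ℤ) (y : Fin (2 * k) → ℝ), elSum k L n (Fin.cons (F n y) y) = 0) :
    ∀ (n : ℤ) (m : ℕ) (hm1 : 1 ≤ m) (hmk : m ≤ k - 1) (y : Fin (2 * k) → ℝ),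
      pd (fun z : Fin (2 * k) → ℝ =>
          (pd (F n) ⟨2 * k - 1, by omega⟩ z)⁻¹ *
            (pd (F n) ⟨k - 1 + m, by omega⟩ z *
                pd (ellFwd k (by omega) L n) ⟨2 * k - 1, by omega⟩ z
              - pd (F n) ⟨2 * k - 1, by omega⟩ z *
                pd (ellFwd k (by omega) L n) ⟨k - 1 + m, by omega⟩ z))
        ⟨2 * k - 1, by omega⟩ y = 0 := by
  intro n m hm1 hmk y
  set e : Fin (2 * k) := ⟨2 * k - 1, by omega⟩
  set a : Fin (2 * k) := ⟨k - 1 + m, by omega⟩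
  set w : (Fin (2 * k) → ℝ) → Fin (k + 1) → ℝ :=
    fun y => Fin.cons (F n y) fun j : Fin k => y ⟨j, by omega⟩
  set g : (Fin (2 * k) → ℝ) → ℝ := fun y => ellFwd k (by omega) L n y + pd (L n) (Fin.last k) (w y)
  have hg : ∀ z (t : ℝ), g (z + t • Pi.single e 1) = g z :=
    outer_terms_translation_invariant k (by omega) (F n) L n (hEL n)
  have hFd : Differentiable ℝ (F n) := (hF n).differentiable (by simp)
  have hhd : Differentiable ℝ (pd (L n) (Fin.last k)) :=
    (contDiff_pd (hL n) _).differentiable (by simp)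
  have hwd : Differentiable ℝ w := by
    rw [differentiable_pi]
    refine Fin.cases hFd fun j => ?_
    exact differentiable_apply _
  have hld : Differentiable ℝ (ellFwd k (by omega) L n) :=
    ((contDiff_pd (hL (n - k)) 0).differentiable (by simp)).comp
      (differentiable_pi.2 fun s => differentiable_apply _)
  have hpd : ∀ i : Fin (2 * k), k ≤ i.val → ∀ z, pd (ellFwd k (by omega) L n) i z =
      pd g i z - pd (F n) i z * pd (pd (L n) (Fin.last k)) 0 (w z) := by
    intro i hi z
    rw [eq_sub_iff_add_eq, ← pd_comp_cons hFd hhd (fun j : Fin k => ⟨j, by omega⟩) i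
      (fun j hj => by have := congrArg Fin.val hj; simp at this; omega) z]
    have := fderiv_fun_add (hld z) ((hhd.comp hwd) z)
    exact (DFunLike.congr_fun this (Pi.single i 1)).symm
  refine pd_eq_zero_of_translation_invariant (fun z t => ?_) y
  have hred : ∀ z, (pd (F n) e z)⁻¹ * (pd (F n) a z * pd (ellFwd k (by omega) L n) e z
      - pd (F n) e z * pd (ellFwd k (by omega) L n) a z) = -pd g a z := by
    intro z
    have hne : pd (F n) e z ≠ 0 := hFnd n z
    rw [hpd e (by simp only [e]; omega), hpd a (by simp only [a]; omega),
      pd_eq_zero_of_translation_invariant hg]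
    field_simp
    ring
  rw [hred, hred, pd_add_of_translation_invariant (fun z => hg z t)]
end

section
/- Let k ≥ 2 and let (F̃_n)_{n∈ℤ} be a family of C^∞ functions F̃_n : ℝ^{2k} → ℝ of the variables (x_{n+k}, …, x_{n−k+1}) with ∂F̃_n/∂x_{n+k} nowhere zero. Suppose a discrete Lagrangian (L_n) of order k is a Lagrangian for the backward recurrence x_{n−k} = F̃_n(x_{n+k}, …, x_{n−k+1}), i.e. for every n ∈ ℤ and all real (x_{n+k}, …, x_{n−k+1}), substituting x_{n−k} = F̃_n(x_{n+k}, …, x_{n−k+1}) into the discrete Euler–Lagrange expression gives Σ_{l=0}^{k} ∂_{l+1} L_{n−l}(x_{n+k−l}, …, x_{n−l}) = 0 identically. Let ℓ̃_n(x_{n+k}, …, x_n) = ∂_{k+1}L_n(x_{n+k}, …, x_n) denote the partial derivative of L_n with respect to its last argument. Then for every m = 1, …, k−1 the following identity holds on all of ℝ^{2k}: ∂/∂x_{n+k}[ (∂F̃_n/∂x_{n+k})^{−1} · ( (∂F̃_n/∂x_{n+m}) ∂ℓ̃_n/∂x_{n+k} − (∂F̃_n/∂x_{n+k}) ∂ℓ̃_n/∂x_{n+m}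 ) ] = 0, where ℓ̃_n is regarded as a function of the 2k variables (x_{n+k}, …, x_{n−k+1}) through the variables (x_{n+k}, …, x_n). -/
/-- `ℓ̃_n(x_{n+k},…,x_n) = ∂_{k+1} L_n(x_{n+k},…,x_n)`, regarded as a function of
the `2k` variables `(x_{n+k},…,x_{n-k+1})` (index `i` corresponds to `x_{n+k-i}`,
so `x_{n+k-s}` is index `s`). -/
noncomputable def ellBwd (k : ℕ) (hk : 1 ≤ k) (L : ℤ → (Fin (k + 1) → ℝ) → ℝ)
    (n : ℤ) (y : Fin (2 * k) → ℝ) : ℝ :=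
  pd (L n) (Fin.last k)
    (fun s : Fin (k + 1) => y ⟨s.val, by have := s.isLt; omega⟩)

section DirectionalDerivative

variable {E E' : Type*} [NormedAddCommGroup E] [NormedSpace ℝ E]
  [NormedAddCommGroup E'] [NormedSpace ℝ E']

theorem fderiv_apply_eq_zero_of_translation_invariant {g : E → ℝ} {v : E}
    (hg : ∀ z (t : ℝ), g (z + t • v) = g z) (z : E) : fderiv ℝ g z v = 0 := by
  by_cases hd : DifferentiableAt ℝ g z
  · rw [← hd.lineDeriv_eq_fderiv, lineDeriv]
    simp [hg]
  · simp [fderiv_zero_of_not_differentiableAt hd]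

theorem fderiv_add_smul_of_translation_invariant {g : E → ℝ} {v : E}
    (hg : ∀ z (t : ℝ), g (z + t • v) = g z) (z : E) (t : ℝ) :
    fderiv ℝ g (z + t • v) = fderiv ℝ g z := by
  rw [← fderiv_comp_add_right]
  simp [hg]

theorem fderiv_comp_clm_add_smul_apply {H : E' → ℝ} {F : E → ℝ} (A : E →L[ℝ] E') (v : E')
    {z e : E} (hH : DifferentiableAt ℝ H (A z + F z • v)) (hF : DifferentiableAt ℝ F z)
    (he : A e = 0) :
    fderiv ℝ (fun w => H (A w + F w • v)) z e
      = fderiv ℝ F z e * fderiv ℝ H (A z + F z • v) v := by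
  have h := hH.hasFDerivAt.comp z (A.hasFDerivAt.add (hF.hasFDerivAt.smul_const v))
  have h' : HasFDerivAt (fun w => H (A w + F w • v)) _ z := h
  rw [h'.fderiv]
  simp [he]

end DirectionalDerivative

/-- The coordinates `(x_n, …, x_{n-k+1})` of `(x_{n+k}, …, x_{n-k+1})`, followed by `0`. -/
noncomputable def lowerCoords (k : ℕ) : (Fin (2 * k) → ℝ) →L[ℝ] (Fin (k + 1) → ℝ) :=
  ContinuousLinearMap.pi fun j =>
    if h : j.val < k then ContinuousLinearMap.proj ⟨k + j.val, by omega⟩ else 0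

theorem lowerCoords_single (k : ℕ) (i : Fin (2 * k)) (hi : i.val < k) :
    lowerCoords k (Pi.single i 1) = 0 := by
  ext j
  by_cases h : j.val < k
  · have hne : (⟨k + j.val, by omega⟩ : Fin (2 * k)) ≠ i := by
      intro h'
      have := congrArg Fin.val h'
      simp only at this
      omega
    simp [lowerCoords, h, hne]
  · simp [lowerCoords, h]

theorem snoc_lower_eq (k : ℕ) (y : Fin (2 * k) → ℝ) (c : ℝ) :
    (fun j : Fin (k + 1) =>
        (Fin.snoc y c : Fin (2 * k + 1) → ℝ) ⟨k + j.val, by omega⟩)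
      = lowerCoords k y + c • Pi.single (Fin.last k) 1 := by
  ext j
  by_cases h : j.val < k
  · have hne : j ≠ Fin.last k := Fin.ne_of_lt h
    have h2 : k + j.val < 2 * k := by omega
    simp [lowerCoords, h, hne, Fin.snoc, h2]
  · obtain rfl : j = Fin.last k := Fin.ext (by simp; omega)
    have h2 : ¬ k + k < 2 * k := by omega
    simp [lowerCoords, Fin.snoc, h2]

/-- The terms of the Euler--Lagrange expression involving neither `x_{n+k}` nor `x_{n-k}`. -/
noncomputable def middleSum (k : ℕ) (L : ℤ → (Fin (k + 1) → ℝ) → ℝ) (n : ℤ)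
    (z : Fin (2 * k) → ℝ) : ℝ :=
  ∑ l : Fin (k - 1), pd (L (n - (l.val + 1 : ℕ))) ⟨k - (l.val + 1), by omega⟩
    (fun j : Fin (k + 1) => z ⟨l.val + 1 + j.val, by omega⟩)

theorem elSum_snoc (k : ℕ) (hk : 1 ≤ k) (L : ℤ → (Fin (k + 1) → ℝ) → ℝ) (n : ℤ)
    (z : Fin (2 * k) → ℝ) (c : ℝ) :
    elSum k L n (Fin.snoc z c) = ellBwd k hk L n z + middleSum k L n z
      + pd (L (n - k)) 0 (lowerCoords k z + c • Pi.single (Fin.last k) 1) := by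
  rw [← snoc_lower_eq]
  obtain ⟨K, rfl⟩ : ∃ K, k = K + 1 := ⟨k - 1, by omega⟩
  rw [elSum, Fin.sum_univ_succ, Fin.sum_univ_castSucc, ← add_assoc]
  congr 1
  · congr 1
    · have h (j : Fin (K + 1 + 1)) : j.val < 2 * (K + 1) := by omega
      simp [ellBwd, Fin.snoc, h, Fin.last, Fin.castLT]
    · refine Finset.sum_congr rfl fun l _ => ?_
      have h (j : Fin (K + 1 + 1)) : l.val + 1 + j.val < 2 * (K + 1) := by
        have := l.isLt
        omega
      simp [Fin.snoc, h, Fin.castLT]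
  · simp

theorem middleSum_add_smul (k : ℕ) (hk : 1 ≤ k) (L : ℤ → (Fin (k + 1) → ℝ) → ℝ) (n : ℤ)
    (z : Fin (2 * k) → ℝ) (t : ℝ) :
    middleSum k L n (z + t • Pi.single ⟨0, by omega⟩ 1) = middleSum k L n z := by
  simp [middleSum]

theorem contDiff_ellBwd (k : ℕ) (hk : 1 ≤ k) {L : ℤ → (Fin (k + 1) → ℝ) → ℝ} {n : ℤ}
    (hL : ContDiff ℝ (⊤ : ℕ∞) (L n)) : ContDiff ℝ (⊤ : ℕ∞) (ellBwd k hk L n) :=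
  (contDiff_pd hL _).comp (contDiff_pi.2 fun _ => contDiff_apply _ _ _)

/-- If a discrete Lagrangian `(L_n)` of order `k ≥ 2` is a Lagrangian for the
backward recurrence `x_{n-k} = F̃_n(x_{n+k},…,x_{n-k+1})`, then
`ℓ̃_n = ∂_{k+1}L_n` satisfies, for every `m = 1,…,k-1`,
`∂/∂x_{n+k}[ (∂F̃_n/∂x_{n+k})⁻¹ ⬝ ( (∂F̃_n/∂x_{n+m}) ∂ℓ̃/∂x_{n+k}
  - (∂F̃_n/∂x_{n+k}) ∂ℓ̃/∂x_{n+m} ) ] = 0` identically on `ℝ^{2k}`.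
Variables `(x_{n+k},…,x_{n-k+1})` are encoded as `Fin (2k) → ℝ` with index `i`
corresponding to `x_{n+k-i}`: `x_{n+k}` is index `0`, `x_{n+m}` is index `k-m`. -/
theorem backward_lagrangian_conditions (k : ℕ) (hk : 2 ≤ k)
    (Ft : ℤ → (Fin (2 * k) → ℝ) → ℝ) (hFt : ∀ n, ContDiff ℝ (⊤ : ℕ∞) (Ft n))
    (hFtnd : ∀ (n : ℤ) (y : Fin (2 * k) → ℝ), pd (Ft n) ⟨0, by omega⟩ y ≠ 0)
    (L : ℤ → (Fin (k + 1) → ℝ) → ℝ) (hL : ∀ n, ContDiff ℝ (⊤ : ℕ∞) (L n))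
    (hEL : ∀ (n : ℤ) (y : Fin (2 * k) → ℝ), elSum k L n (Fin.snoc y (Ft n y)) = 0) :
    ∀ (n : ℤ) (m : ℕ) (hm1 : 1 ≤ m) (hmk : m ≤ k - 1) (y : Fin (2 * k) → ℝ),
      pd (fun z : Fin (2 * k) → ℝ =>
          (pd (Ft n) ⟨0, by omega⟩ z)⁻¹ *
            (pd (Ft n) ⟨k - m, by omega⟩ z *
                pd (ellBwd k (by omega) L n) ⟨0, by omega⟩ z
              - pd (Ft n) ⟨0, by omega⟩ z *
                pd (ellBwd k (by omega) L n) ⟨k - m, by omega⟩ z))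
        ⟨0, by omega⟩ y = 0 := by
  intro n m hm1 hmk y
  set H : (Fin (k + 1) → ℝ) → ℝ := pd (L (n - k)) 0
  set ℓ := ellBwd k (by omega) L n
  set v : Fin (k + 1) → ℝ := Pi.single (Fin.last k) 1
  have hH : Differentiable ℝ H := (contDiff_pd (hL _) 0).differentiable (by simp)
  have hF : Differentiable ℝ (Ft n) := (hFt n).differentiable (by simp)
  have hℓ : Differentiable ℝ ℓ := (contDiff_ellBwd k _ (hL n)).differentiable (by simp)
  have hc : Differentiable ℝ fun z => H (lowerCoords k z + Ft n z • v) :=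
    hH.comp ((lowerCoords k).differentiable.add (hF.smul_const v))
  have hmid : middleSum k L n = fun z => -(ℓ z + H (lowerCoords k z + Ft n z • v)) := by
    ext z
    have := hEL n z
    rw [elSum_snoc k (by omega)] at this
    linarith
  have hinv := middleSum_add_smul k (by omega) L n
  have hpd (i : Fin (2 * k)) (hi : i.val < k) (z : Fin (2 * k) → ℝ) :
      pd (middleSum k L n) i z
        = -(pd ℓ i z + pd (Ft n) i z * fderiv ℝ H (lowerCoords k z + Ft n z • v) v) := by
    simp only [pd]
    rw [hmid, fderiv_fun_neg, fderiv_fun_add (hℓ z) (hc z)]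
    simp only [neg_apply, add_apply]
    rw [fderiv_comp_clm_add_smul_apply _ _ (hH _) (hF z) (lowerCoords_single k i hi)]
  have hfun : (fun z : Fin (2 * k) → ℝ =>
      (pd (Ft n) ⟨0, by omega⟩ z)⁻¹ *
        (pd (Ft n) ⟨k - m, by omega⟩ z * pd ℓ ⟨0, by omega⟩ z
          - pd (Ft n) ⟨0, by omega⟩ z * pd ℓ ⟨k - m, by omega⟩ z))
      = pd (middleSum k L n) ⟨k - m, by omega⟩ := by
    ext z
    have h0 := hpd ⟨0, by omega⟩ (by simp; omega) z
    have h0' : pd (middleSum k L n) ⟨0, by omega⟩ z = 0 :=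
      fderiv_apply_eq_zero_of_translation_invariant hinv z
    rw [inv_mul_eq_iff_eq_mul₀ (hFtnd n z), hpd ⟨k - m, by omega⟩ (by simp; omega) z]
    linear_combination pd (Ft n) ⟨k - m, by omega⟩ z * (h0 - h0')
  rw [hfun]
  refine fderiv_apply_eq_zero_of_translation_invariant (fun z t => ?_) y
  rw [pd, pd, fderiv_add_smul_of_translation_invariant hinv]
end
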